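/- For any probability densities F_N, H_N on ℝ^N with finite first moments, d_{T1,N}(Φ[F_N], Φ[H_N]) ≤ (1 − (1−γ)/(4N)) d_{T1,N}(F_N, H_N). -/

import Mathlib

open MeasureTheory Real Finset

noncomputable section

/-- The state space of `N` one-dimensional velocities. -/
abbrev V (N : ℕ) := Fin N → ℝ

/-- A probability density on `ℝ^N`. -/
def IsProbDensity {N : ℕ} (F : V N → ℝ) : Prop :=
  (∀ v, 0 ≤ F v) ∧ Integrable F ∧ ∫ v, F v = 1

/-- A probability density on `ℝ`. -/
def IsProbDensity1 (g : ℝ → ℝ) : Prop :=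
  (∀ x, 0 ≤ g x) ∧ Integrable g ∧ ∫ x, g x = 1

/-- The velocity vector after the Kac collision of particles `i` and `j` with angle `θ`. -/
def collide {N : ℕ} (v : V N) (i j : Fin N) (θ : ℝ) : V N :=
  Function.update (Function.update v i (v i * Real.cos θ + v j * Real.sin θ)) j
    (-(v i) * Real.sin θ + v j * Real.cos θ)

/-- Kac's collision operator `Q`. -/
def QOp {N : ℕ} (F : V N → ℝ) : V N → ℝ := fun v =>
  (N.choose 2 : ℝ)⁻¹ * ∑ i : Fin N, ∑ j : Fin N,
    if i < j then (2 * π)⁻¹ * ∫ θ in (0:ℝ)..(2 * π), F (collide v i j θ) else 0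

/-- The thermostat operator `R_j` with reservoir distribution `g`. -/
def ROp {N : ℕ} (g : ℝ → ℝ) (j : Fin N) (F : V N → ℝ) : V N → ℝ := fun v =>
  ∫ w : ℝ, (2 * π)⁻¹ * ∫ θ in (0:ℝ)..(2 * π),
    g (w * Real.cos θ - v j * Real.sin θ) *
      F (Function.update v j (v j * Real.cos θ + w * Real.sin θ))

/-- The fixed point operator `Φ = γ Q + (1-γ) (1/N) ∑ⱼ Rⱼ`. -/
def PhiOp {N : ℕ} (γ : ℝ) (g : ℝ → ℝ) (F : V N → ℝ) : V N → ℝ := fun v =>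
  γ * QOp F v + (1 - γ) * (N : ℝ)⁻¹ * ∑ j : Fin N, ROp g j F v

/-- Fourier transform of a density on `ℝ^N`. -/
def ft {N : ℕ} (f : V N → ℝ) (ξ : V N) : ℂ :=
  ∫ v : V N, (f v : ℂ) * Complex.exp (-Complex.I * ((∑ i, v i * ξ i : ℝ) : ℂ))

/-- Fourier transform of a density on `ℝ`. -/
def ft1 (f : ℝ → ℝ) (ξ : ℝ) : ℂ :=
  ∫ v : ℝ, (f v : ℂ) * Complex.exp (-Complex.I * ((v * ξ : ℝ) : ℂ))

/-- The Gabetta–Toscani–Wennberg distance on `ℝ^N`. -/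
def dGTW {N : ℕ} (f h : V N → ℝ) : ℝ :=
  ⨆ ξ : {ξ : V N // ξ ≠ 0}, ‖ft f ξ.1 - ft h ξ.1‖ / (∑ i, (ξ.1 i) ^ 2)

/-- The `T1` distance on `ℝ^N`. -/
def dT1 {N : ℕ} (f h : V N → ℝ) : ℝ :=
  ⨆ ξ : {ξ : V N // ξ ≠ 0}, ‖ft f ξ.1 - ft h ξ.1‖ / Real.sqrt (∑ i, (ξ.1 i) ^ 2)

/-- The Gabetta–Toscani–Wennberg distance on `ℝ`. -/
def dGTW1 (f h : ℝ → ℝ) : ℝ :=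
  ⨆ ξ : {ξ : ℝ // ξ ≠ 0}, ‖ft1 f ξ.1 - ft1 h ξ.1‖ / (ξ.1) ^ 2

/-- The `T1` distance on `ℝ`. -/
def dT11 (f h : ℝ → ℝ) : ℝ :=
  ⨆ ξ : {ξ : ℝ // ξ ≠ 0}, ‖ft1 f ξ.1 - ft1 h ξ.1‖ / |ξ.1|

/-- `F : ℝ → V N → ℝ` is a solution of the coupled Kac master equation
`∂ₜ F = -λN(I-Q)[F] - μ ∑ⱼ (I-Rⱼ)[F]`. -/
def IsSolution {N : ℕ} (lam mu : ℝ) (g : ℝ → ℝ) (F : ℝ → V N → ℝ) : Prop :=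
  (∀ t, IsProbDensity (F t)) ∧
    ∀ t v, HasDerivAt (fun s => F s v)
      (-(lam * N) * (F t v - QOp (F t) v) - mu * ∑ j : Fin N, (F t v - ROp g j (F t) v)) t

/-- `N`-fold tensor power of a density on `ℝ`. -/
def tensorPow (f : ℝ → ℝ) (N : ℕ) : V N → ℝ := fun v => ∏ i, f (v i)

/-- First marginal of a density on `ℝ^N`. -/
def marg1 {N : ℕ} (F : V N → ℝ) : ℝ → ℝ := fun x =>
  ∫ w : V (N - 1),
    F (fun i => if h : (i : ℕ) = 0 then x else w ⟨(i : ℕ) - 1, by have := i.isLt; omega⟩)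

/-- The `k`-th marginal of a density on `ℝ^N`. -/
def marg {N : ℕ} (k : ℕ) (F : V N → ℝ) : V k → ℝ := fun u =>
  ∫ w : V (N - k),
    F (fun i => if h : (i : ℕ) < k then u ⟨(i : ℕ), h⟩
        else w ⟨(i : ℕ) - k, by have := i.isLt; omega⟩)

/-- A density symmetric under permutations of the variables. -/
def IsSymmetric {N : ℕ} (F : V N → ℝ) : Prop :=
  ∀ σ : Equiv.Perm (Fin N), ∀ v : V N, F (v ∘ σ) = F v

/-- `π` is a coupling of `μ` and `ν`. -/
def Coupling {α β : Type*} [MeasurableSpace α] [MeasurableSpace β]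
    (γ : Measure (α × β)) (μ : Measure α) (ν : Measure β) : Prop :=
  γ.map Prod.fst = μ ∧ γ.map Prod.snd = ν

/-- Wasserstein-2 distance between measures on `ℝ^N` (Euclidean cost). -/
def W2 {N : ℕ} (μ ν : Measure (V N)) : ℝ :=
  sInf {c | ∃ γ : Measure (V N × V N), Coupling γ μ ν ∧
    c = Real.sqrt (∫ p, ∑ i, (p.1 i - p.2 i) ^ 2 ∂γ)}

/-- Wasserstein-2 distance between measures on `ℝ`. -/
def W2r (μ ν : Measure ℝ) : ℝ :=
  sInf {c | ∃ γ : Measure (ℝ × ℝ), Coupling γ μ ν ∧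
    c = Real.sqrt (∫ p, (p.1 - p.2) ^ 2 ∂γ)}

/-- The measure on `ℝ^N` with density `F`. -/
def densMeasure {N : ℕ} (F : V N → ℝ) : Measure (V N) :=
  volume.withDensity fun v => ENNReal.ofReal (F v)

/-- The measure on `ℝ` with density `f`. -/
def densMeasure1 (f : ℝ → ℝ) : Measure ℝ :=
  volume.withDensity fun x => ENNReal.ofReal (f x)

/-- The average of `F` over all rotations in the `(i, j)`-plane. -/
def pairAvg {N : ℕ} (i j : Fin N) (F : V N → ℝ) : V N → ℝ := fun v =>
  (2 * π)⁻¹ * ∫ θ in (0:ℝ)..(2 * π), F (collide v i j θ)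

/-- The Fourier character on `ℝ^N`. -/
def character {N : ℕ} (v ξ : V N) : ℂ :=
  Complex.exp (-Complex.I * ((∑ i, v i * ξ i : ℝ) : ℂ))

lemma ft_eq_integral_character {N : ℕ} (f : V N → ℝ) (ξ : V N) :
    ft f ξ = ∫ v, (f v : ℂ) * character v ξ := rfl

lemma norm_character {N : ℕ} (v ξ : V N) : ‖character v ξ‖ = 1 := by
  unfold character
  rw [neg_mul, ← mul_neg, ← Complex.ofReal_neg, Complex.norm_exp_I_mul_ofReal]

@[fun_prop]
lemma continuous_character {N : ℕ} (ξ : V N) : Continuous fun v => character v ξ := by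
  unfold character
  fun_prop

lemma integrable_mul_character {N : ℕ} {F : V N → ℝ} (hF : Integrable F) (ξ : V N) :
    Integrable fun v => (F v : ℂ) * character v ξ :=
  hF.ofReal.mul_bdd (c := 1) (continuous_character ξ).aestronglyMeasurable
    (.of_forall fun v => (norm_character v ξ).le)

lemma ft_add {N : ℕ} {f h : V N → ℝ} (hf : Integrable f) (hh : Integrable h) (ξ : V N) :
    ft (fun v => f v + h v) ξ = ft f ξ + ft h ξ := by
  simp only [ft_eq_integral_character, Complex.ofReal_add, add_mul]
  exact integral_add (integrable_mul_character hf ξ) (integrable_mul_character hh ξ)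

lemma ft_const_mul {N : ℕ} (c : ℝ) (f : V N → ℝ) (ξ : V N) :
    ft (fun v => c * f v) ξ = c * ft f ξ := by
  simp only [ft_eq_integral_character, Complex.ofReal_mul, mul_assoc]
  exact integral_const_mul _ _

lemma ft_sum {N : ℕ} {ι : Type*} (s : Finset ι) {f : ι → V N → ℝ}
    (hf : ∀ i ∈ s, Integrable (f i)) (ξ : V N) :
    ft (fun v => ∑ i ∈ s, f i v) ξ = ∑ i ∈ s, ft (f i) ξ := by
  simp only [ft_eq_integral_character, Complex.ofReal_sum, Finset.sum_mul]
  exact integral_finsetSum _ fun i hi => integrable_mul_character (hf i hi) ξ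

lemma integral_comp_of_measurePreserving {α β E : Type*} [MeasurableSpace α] [MeasurableSpace β]
    [NormedAddCommGroup E] [NormedSpace ℝ E] {μ : Measure α} {ν : Measure β} {T : α → β}
    (hT : MeasurePreserving T μ ν) {f : β → E} (hf : AEStronglyMeasurable f ν) :
    ∫ x, f (T x) ∂μ = ∫ y, f y ∂ν := by
  obtain ⟨hTm, rfl⟩ := hT
  exact (integral_map hTm.aemeasurable hf).symm

lemma collide_apply {N : ℕ} (v : V N) (i j : Fin N) (θ : ℝ) (k : Fin N) :
    collide v i j θ k = if k = j then -(v i) * Real.sin θ + v j * Real.cos θ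
      else if k = i then v i * Real.cos θ + v j * Real.sin θ else v k := by
  simp only [collide, Function.update_apply]

lemma sum_collide_mul_collide {N : ℕ} {i j : Fin N} (hij : i ≠ j) (v ξ : V N) (θ : ℝ) :
    ∑ k, collide v i j θ k * collide ξ i j θ k = ∑ k, v k * ξ k := by
  rw [← sub_eq_zero, ← Finset.sum_sub_distrib, Fintype.sum_eq_add i j hij]
  · simp only [collide_apply, hij, if_true, if_false]
    linear_combination (v i * ξ i + v j * ξ j) * Real.sin_sq_add_cos_sq θ
  · rintro k ⟨hi, hj⟩
    simp [collide_apply, hi, hj]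

lemma sum_sq_collide {N : ℕ} {i j : Fin N} (hij : i ≠ j) (ξ : V N) (θ : ℝ) :
    ∑ k, collide ξ i j θ k ^ 2 = ∑ k, ξ k ^ 2 := by
  simpa only [sq] using sum_collide_mul_collide hij ξ ξ θ

lemma character_collide {N : ℕ} {i j : Fin N} (hij : i ≠ j) (v ξ : V N) (θ : ℝ) :
    character (collide v i j θ) (collide ξ i j θ) = character v ξ := by
  simp only [character, sum_collide_mul_collide hij]

lemma continuous_collide {N : ℕ} (i j : Fin N) :
    Continuous fun p : ℝ × V N => collide p.2 i j p.1 := by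
  refine continuous_pi fun k => ?_
  simp only [collide_apply]
  split_ifs <;> fun_prop

/-- A linear map of `ℝ^N` preserving the sum of squares preserves Lebesgue measure. -/
lemma measurePreserving_of_sum_sq {N : ℕ} (L : V N →ₗ[ℝ] V N)
    (hL : ∀ v, ∑ k, L v k ^ 2 = ∑ k, v k ^ 2) : MeasurePreserving L := by
  let e := WithLp.linearEquiv 2 ℝ (V N)
  let T : EuclideanSpace ℝ (Fin N) →ₗᵢ[ℝ] EuclideanSpace ℝ (Fin N) :=
    { toLinearMap := e.symm.toLinearMap ∘ₗ L ∘ₗ e.toLinearMap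
      norm_map' := fun x => by
        simp only [EuclideanSpace.norm_eq, Real.norm_eq_abs, sq_abs]
        exact congrArg Real.sqrt (hL x.ofLp) }
  exact (PiLp.volume_preserving_ofLp (Fin N)).comp
    ((T.toLinearIsometryEquiv rfl).measurePreserving.comp (PiLp.volume_preserving_toLp (Fin N)))

lemma measurePreserving_collide {N : ℕ} {i j : Fin N} (hij : i ≠ j) (θ : ℝ) :
    MeasurePreserving fun v : V N => collide v i j θ := by
  refine measurePreserving_of_sum_sq
    { toFun := fun v => collide v i j θ
      map_add' := fun v w => ?_
      map_smul' := fun c v => ?_ } fun v => sum_sq_collide hij v θ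
  · ext k
    simp only [collide_apply, Pi.add_apply]
    split_ifs <;> ring
  · ext k
    simp only [collide_apply, Pi.smul_apply, smul_eq_mul, RingHom.id_apply]
    split_ifs <;> ring

lemma integrable_comp_collide {N : ℕ} {i j : Fin N} (hij : i ≠ j) {F : V N → ℝ}
    (hF : Integrable F) :
    Integrable (fun p : ℝ × V N => F (collide p.2 i j p.1))
      ((volume.restrict (Set.Ioc 0 (2 * π))).prod volume) := by
  have hmp : MeasurePreserving (fun p : ℝ × V N => (p.1, collide p.2 i j p.1))
      ((volume.restrict (Set.Ioc 0 (2 * π))).prod volume)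
      ((volume.restrict (Set.Ioc 0 (2 * π))).prod volume) :=
    (MeasurePreserving.id _).skew_product (continuous_collide i j).measurable
      (.of_forall fun θ => (measurePreserving_collide hij θ).map_eq)
  exact hmp.integrable_comp_of_integrable (hF.comp_snd _)

lemma pairAvg_eq {N : ℕ} (i j : Fin N) (F : V N → ℝ) (v : V N) :
    pairAvg i j F v = (2 * π)⁻¹ * ∫ θ in Set.Ioc 0 (2 * π), F (collide v i j θ) := by
  rw [pairAvg, intervalIntegral.integral_of_le (by positivity)]

lemma integrable_pairAvg {N : ℕ} {i j : Fin N} (hij : i ≠ j) {F : V N → ℝ}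
    (hF : Integrable F) : Integrable (pairAvg i j F) := by
  simp_rw [funext (pairAvg_eq i j F)]
  exact (integrable_comp_collide hij hF).integral_prod_right.const_mul _

lemma ft_collide {N : ℕ} {i j : Fin N} (hij : i ≠ j) {F : V N → ℝ} (hF : Integrable F)
    (ξ : V N) (θ : ℝ) :
    ∫ v, (F (collide v i j θ) : ℂ) * character v ξ = ft F (collide ξ i j θ) := by
  simp only [← character_collide hij _ ξ θ]
  exact integral_comp_of_measurePreserving (measurePreserving_collide hij θ)
    (integrable_mul_character hF (collide ξ i j θ)).1

lemma integrable_comp_collide_mul_character {N : ℕ} {i j : Fin N} (hij : i ≠ j)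
    {F : V N → ℝ} (hF : Integrable F) (ξ : V N) :
    Integrable (fun p : ℝ × V N => (F (collide p.2 i j p.1) : ℂ) * character p.2 ξ)
      ((volume.restrict (Set.Ioc 0 (2 * π))).prod volume) :=
  (integrable_comp_collide hij hF).ofReal.mul_bdd (c := 1)
    ((continuous_character ξ).comp continuous_snd).aestronglyMeasurable
    (.of_forall fun p => (norm_character p.2 ξ).le)

lemma integrable_ft_collide {N : ℕ} {i j : Fin N} (hij : i ≠ j) {F : V N → ℝ}
    (hF : Integrable F) (ξ : V N) :
    IntervalIntegrable (fun θ => ft F (collide ξ i j θ)) volume 0 (2 * π) := by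
  rw [intervalIntegrable_iff_integrableOn_Ioc_of_le (by positivity)]
  simp_rw [IntegrableOn, ← ft_collide hij hF ξ]
  exact (integrable_comp_collide_mul_character hij hF ξ).integral_prod_left

lemma ft_pairAvg {N : ℕ} {i j : Fin N} (hij : i ≠ j) {F : V N → ℝ} (hF : Integrable F)
    (ξ : V N) :
    ft (pairAvg i j F) ξ =
      ((2 * π)⁻¹ : ℝ) * ∫ θ in (0:ℝ)..(2 * π), ft F (collide ξ i j θ) := by
  rw [intervalIntegral.integral_of_le (by positivity)]
  simp_rw [← ft_collide hij hF ξ]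
  rw [integral_integral_swap (integrable_comp_collide_mul_character hij hF ξ),
    funext (pairAvg_eq i j F), ft_const_mul, ft_eq_integral_character]
  congr 2 with v
  rw [integral_mul_const, integral_complex_ofReal]

lemma norm_ft_pairAvg_sub_le {N : ℕ} {i j : Fin N} (hij : i ≠ j) {F H : V N → ℝ}
    (hF : Integrable F) (hH : Integrable H) (ξ : V N) {b : ℝ → ℝ}
    (hb : IntervalIntegrable b volume 0 (2 * π))
    (h : ∀ θ, ‖ft F (collide ξ i j θ) - ft H (collide ξ i j θ)‖ ≤ b θ) :
    ‖ft (pairAvg i j F) ξ - ft (pairAvg i j H) ξ‖ ≤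
      (2 * π)⁻¹ * ∫ θ in (0:ℝ)..(2 * π), b θ := by
  have hπ : (0:ℝ) ≤ 2 * π := by positivity
  rw [ft_pairAvg hij hF, ft_pairAvg hij hH, ← mul_sub,
    ← intervalIntegral.integral_sub (integrable_ft_collide hij hF ξ)
      (integrable_ft_collide hij hH ξ), norm_mul, Complex.norm_real, Real.norm_eq_abs,
    abs_of_nonneg (by positivity)]
  gcongr
  exact intervalIntegral.norm_integral_le_of_norm_le hπ (.of_forall fun θ _ => h θ) hb

lemma measurePreserving_cons (N : ℕ) :
    MeasurePreserving (fun p : V N × ℝ => (Fin.cons p.2 p.1 : V (N + 1)))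
      (volume.prod volume) volume := by
  have h := (volume_preserving_piFinSuccAbove (fun _ : Fin (N + 1) => ℝ) 0).symm
  have hcons : (fun p : V N × ℝ => (Fin.cons p.2 p.1 : V (N + 1))) =
      (MeasurableEquiv.piFinSuccAbove (fun _ : Fin (N + 1) => ℝ) 0).symm ∘ Prod.swap := by
    funext p
    simp [MeasurableEquiv.piFinSuccAbove, Fin.insertNthEquiv, Fin.insertNth_zero']
  rw [hcons]
  exact h.comp Measure.measurePreserving_swap

lemma integral_cons {N : ℕ} {E : Type*} [NormedAddCommGroup E] [NormedSpace ℝ E]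
    {f : V (N + 1) → E} (hf : Integrable f) :
    ∫ v : V N, ∫ w : ℝ, f (Fin.cons w v) = ∫ u, f u := by
  have hmp := measurePreserving_cons N
  rw [← integral_prod (f := fun p : V N × ℝ => f (Fin.cons p.2 p.1))
    (hmp.integrable_comp_of_integrable hf)]
  exact integral_comp_of_measurePreserving hmp hf.1

lemma integrable_integral_cons {N : ℕ} {f : V (N + 1) → ℝ} (hf : Integrable f) :
    Integrable fun v : V N => ∫ w : ℝ, f (Fin.cons w v) :=
  ((measurePreserving_cons N).integrable_comp_of_integrable hf).integral_prod_left

lemma character_cons {N : ℕ} (w η : ℝ) (v ξ : V N) :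
    character (Fin.cons w v : V (N + 1)) (Fin.cons η ξ) =
      Complex.exp (-Complex.I * ((w * η : ℝ) : ℂ)) * character v ξ := by
  simp only [character, Fin.sum_univ_succ, Fin.cons_zero, Fin.cons_succ, ← Complex.exp_add]
  push_cast
  ring_nf

lemma ft_marginal {N : ℕ} {f : V (N + 1) → ℝ} (hf : Integrable f) (ξ : V N) :
    ft (fun v : V N => ∫ w : ℝ, f (Fin.cons w v)) ξ = ft f (Fin.cons 0 ξ) := by
  rw [ft_eq_integral_character f, ← integral_cons (integrable_mul_character hf _)]
  simp only [ft_eq_integral_character, character_cons, mul_zero, Complex.ofReal_zero,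
    Complex.exp_zero, one_mul]
  congr 1 with v
  rw [integral_mul_const, integral_complex_ofReal]

/-- The joint density of a reservoir particle (coordinate `0`) and the `N` particles. -/
def withReservoir {N : ℕ} (g : ℝ → ℝ) (F : V N → ℝ) : V (N + 1) → ℝ := fun u =>
  g (u 0) * F (Fin.tail u)

lemma integrable_withReservoir {N : ℕ} {g : ℝ → ℝ} {F : V N → ℝ} (hg : Integrable g)
    (hF : Integrable F) : Integrable (withReservoir g F) := by
  have h := volume_preserving_piFinSuccAbove (fun _ : Fin (N + 1) => ℝ) 0
  exact h.integrable_comp_of_integrable (hg.mul_prod hF)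

lemma ft_withReservoir {N : ℕ} {g : ℝ → ℝ} {F : V N → ℝ} (hg : Integrable g)
    (hF : Integrable F) (η : V (N + 1)) :
    ft (withReservoir g F) η = ft1 g (η 0) * ft F (Fin.tail η) := by
  rw [ft_eq_integral_character,
    ← integral_cons (integrable_mul_character (integrable_withReservoir hg hF) η),
    ft_eq_integral_character, ft1, ← integral_const_mul]
  congr 1 with v
  rw [← integral_mul_const]
  congr 1 with w
  conv_lhs => rw [← Fin.cons_self_tail η, character_cons]
  simp only [withReservoir, Fin.cons_zero, Fin.tail_cons]
  push_cast
  ring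

lemma norm_ft1_le_one {g : ℝ → ℝ} (hg : IsProbDensity1 g) (η : ℝ) : ‖ft1 g η‖ ≤ 1 := by
  refine (norm_integral_le_integral_norm _).trans_eq ?_
  rw [← hg.2.2]
  congr 1 with v
  rw [norm_mul, neg_mul, ← mul_neg, ← Complex.ofReal_neg, Complex.norm_exp_I_mul_ofReal,
    mul_one, Complex.norm_real, Real.norm_of_nonneg (hg.1 v)]

lemma ROp_eq_integral_pairAvg {N : ℕ} (g : ℝ → ℝ) (j : Fin N) (F : V N → ℝ) :
    ROp g j F =
      fun v => ∫ w : ℝ, pairAvg j.succ 0 (withReservoir g F) (Fin.cons w v) := by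
  funext v
  simp only [ROp, pairAvg]
  congr 1 with w
  congr 2 with θ
  congr 2
  · simp [collide_apply]
    ring
  · ext k
    simp [Fin.tail, collide_apply, Function.update_apply]

lemma integrable_ROp {N : ℕ} {g : ℝ → ℝ} (hg : Integrable g) (j : Fin N) {F : V N → ℝ}
    (hF : Integrable F) : Integrable (ROp g j F) := by
  rw [ROp_eq_integral_pairAvg]
  exact integrable_integral_cons
    (integrable_pairAvg (Fin.succ_ne_zero j) (integrable_withReservoir hg hF))

lemma sqrt_sub_le {a x : ℝ} (ha : 0 < a) (hx : x ≤ a ^ 2) :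
    √(a ^ 2 - x) ≤ a - x / (2 * a) := by
  have h : a - x / (2 * a) = (2 * a ^ 2 - x) / (2 * a) := by field_simp
  refine Real.sqrt_le_iff.2 ⟨h ▸ div_nonneg (by nlinarith) (by positivity), ?_⟩
  have : (a - x / (2 * a)) ^ 2 = a ^ 2 - x + (x / (2 * a)) ^ 2 := by field_simp; ring
  nlinarith [sq_nonneg (x / (2 * a))]

lemma norm_ft_pairAvg_sub_le_mul_sqrt {N : ℕ} {i j : Fin N} (hij : i ≠ j) {F H : V N → ℝ}
    (hF : Integrable F) (hH : Integrable H) {d : ℝ}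
    (h : ∀ ξ, ‖ft F ξ - ft H ξ‖ ≤ d * √(∑ k, ξ k ^ 2)) (ξ : V N) :
    ‖ft (pairAvg i j F) ξ - ft (pairAvg i j H) ξ‖ ≤ d * √(∑ k, ξ k ^ 2) := by
  have := norm_ft_pairAvg_sub_le hij hF hH ξ (b := fun _ => d * √(∑ k, ξ k ^ 2))
    intervalIntegrable_const fun θ => (h _).trans_eq (by rw [sum_sq_collide hij])
  refine this.trans_eq ?_
  rw [intervalIntegral.integral_const, smul_eq_mul, sub_zero, inv_mul_cancel_left₀]
  positivity

lemma sqrt_sum_sq_pos {N : ℕ} {ξ : V N} (hξ : ξ ≠ 0) : 0 < √(∑ i, ξ i ^ 2) := by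
  obtain ⟨k, hk⟩ := Function.ne_iff.1 hξ
  exact Real.sqrt_pos.2 (Finset.sum_pos' (fun k _ => sq_nonneg _)
    ⟨k, Finset.mem_univ k, sq_pos_of_ne_zero hk⟩)

lemma norm_ft_ROp_sub_le {N : ℕ} {g : ℝ → ℝ} (hg : IsProbDensity1 g) (j : Fin N)
    {F H : V N → ℝ} (hF : Integrable F) (hH : Integrable H) {d : ℝ} (hd : 0 ≤ d)
    (h : ∀ ξ, ‖ft F ξ - ft H ξ‖ ≤ d * √(∑ k, ξ k ^ 2)) {ξ : V N} (hξ : ξ ≠ 0) :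
    ‖ft (ROp g j F) ξ - ft (ROp g j H) ξ‖ ≤
      d * (√(∑ k, ξ k ^ 2) - ξ j ^ 2 / (4 * √(∑ k, ξ k ^ 2))) := by
  have hne := Fin.succ_ne_zero j
  have hF' := integrable_withReservoir hg.2.1 hF
  have hH' := integrable_withReservoir hg.2.1 hH
  set r := √(∑ k, ξ k ^ 2) with hr
  have hr2 : r ^ 2 = ∑ k, ξ k ^ 2 := Real.sq_sqrt (Finset.sum_nonneg fun k _ => sq_nonneg _)
  have hj : ξ j ^ 2 ≤ r ^ 2 :=
    hr2 ▸ Finset.single_le_sum (f := fun k => ξ k ^ 2) (fun k _ => sq_nonneg _)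
      (Finset.mem_univ j)
  have hr0 : 0 < r := sqrt_sum_sq_pos hξ
  rw [ROp_eq_integral_pairAvg, ROp_eq_integral_pairAvg, ft_marginal (integrable_pairAvg hne hF'),
    ft_marginal (integrable_pairAvg hne hH')]
  refine (norm_ft_pairAvg_sub_le hne hF' hH' _
    (b := fun θ => d * (r - ξ j ^ 2 / (2 * r) * Real.sin θ ^ 2))
    (Continuous.intervalIntegrable (by fun_prop) _ _) fun θ => ?_).trans_eq ?_
  · set η := collide (Fin.cons 0 ξ : V (N + 1)) j.succ 0 θ with hη
    have hη0 : η 0 = -(ξ j) * Real.sin θ := by simp [hη, collide_apply]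
    have hsum : ∑ k, Fin.tail η k ^ 2 = r ^ 2 - ξ j ^ 2 * Real.sin θ ^ 2 := by
      have := sum_sq_collide hne (Fin.cons 0 ξ : V (N + 1)) θ
      rw [← hη, Fin.sum_univ_succ, Fin.sum_univ_succ (n := N), hη0, Fin.cons_zero] at this
      simp only [Fin.cons_succ] at this
      simp only [Fin.tail, hr2]
      linear_combination this
    rw [ft_withReservoir hg.2.1 hF, ft_withReservoir hg.2.1 hH, ← mul_sub, norm_mul]
    calc _ ≤ 1 * (d * √(∑ k, Fin.tail η k ^ 2)) := by
          gcongr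
          exacts [norm_ft1_le_one hg _, h _]
      _ ≤ d * (r - ξ j ^ 2 * Real.sin θ ^ 2 / (2 * r)) := by
          rw [one_mul, hsum]
          gcongr
          refine sqrt_sub_le hr0 ?_
          nlinarith [Real.sin_sq_le_one θ, sq_nonneg (ξ j)]
      _ = _ := by ring
  · rw [intervalIntegral.integral_const_mul, intervalIntegral.integral_sub
      intervalIntegrable_const (Continuous.intervalIntegrable (by fun_prop) _ _),
      intervalIntegral.integral_const_mul, integral_sin_sq, intervalIntegral.integral_const]
    simp only [Real.sin_two_pi, Real.sin_zero, smul_eq_mul]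
    field_simp
    ring

lemma QOp_eq_sum_pairAvg {N : ℕ} (F : V N → ℝ) :
    QOp F = fun v => (N.choose 2 : ℝ)⁻¹ *
      ∑ p : Fin N × Fin N with p.1 < p.2, pairAvg p.1 p.2 F v := by
  funext v
  rw [QOp, Finset.sum_filter, Fintype.sum_prod_type]
  rfl

lemma integrable_QOp {N : ℕ} {F : V N → ℝ} (hF : Integrable F) : Integrable (QOp F) := by
  rw [QOp_eq_sum_pairAvg]
  exact (integrable_finsetSum _ fun p hp =>
    integrable_pairAvg (Finset.mem_filter.1 hp).2.ne hF).const_mul _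

lemma card_filter_lt (N : ℕ) :
    #{p : Fin N × Fin N | p.1 < p.2} = N.choose 2 := by
  rw [Finset.card_filter, Fintype.sum_prod_type_right]
  simp only [← Finset.card_filter, Finset.filter_gt_eq_Iio, Fin.card_Iio]
  rw [Fin.sum_univ_eq_sum_range (fun k => k) N, Finset.sum_range_id, Nat.choose_two_right]

lemma norm_ft_QOp_sub_le {N : ℕ} (hN : 2 ≤ N) {F H : V N → ℝ}
    (hF : Integrable F) (hH : Integrable H) {d : ℝ}
    (h : ∀ ξ, ‖ft F ξ - ft H ξ‖ ≤ d * √(∑ k, ξ k ^ 2)) (ξ : V N) :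
    ‖ft (QOp F) ξ - ft (QOp H) ξ‖ ≤ d * √(∑ k, ξ k ^ 2) := by
  have hC : (0:ℝ) < N.choose 2 := by exact_mod_cast Nat.choose_pos hN
  rw [QOp_eq_sum_pairAvg, QOp_eq_sum_pairAvg, ft_const_mul, ft_const_mul,
    ft_sum _ fun p hp => integrable_pairAvg (Finset.mem_filter.1 hp).2.ne hF,
    ft_sum _ fun p hp => integrable_pairAvg (Finset.mem_filter.1 hp).2.ne hH, ← mul_sub,
    ← Finset.sum_sub_distrib, norm_mul, Complex.norm_real, Real.norm_of_nonneg (by positivity),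
    inv_mul_le_iff₀ hC]
  refine (norm_sum_le_of_le _ fun p hp =>
    norm_ft_pairAvg_sub_le_mul_sqrt (Finset.mem_filter.1 hp).2.ne hF hH h ξ).trans_eq ?_
  rw [Finset.sum_const, card_filter_lt, nsmul_eq_mul]

lemma ft_PhiOp {N : ℕ} (γ : ℝ) {g : ℝ → ℝ} (hg : Integrable g) {F : V N → ℝ}
    (hF : Integrable F) (ξ : V N) :
    ft (PhiOp γ g F) ξ =
      γ * ft (QOp F) ξ + ((1 - γ) * (N : ℝ)⁻¹ : ℝ) * ∑ j, ft (ROp g j F) ξ := by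
  have hR : ∀ j ∈ Finset.univ, Integrable (ROp g j F) := fun j _ => integrable_ROp hg j hF
  unfold PhiOp
  rw [ft_add ((integrable_QOp hF).const_mul _) ((integrable_finsetSum _ hR).const_mul _),
    ft_const_mul, ft_const_mul, ft_sum _ hR]

lemma ft_zero {N : ℕ} {F : V N → ℝ} (hF : IsProbDensity F) : ft F 0 = 1 := by
  simp only [ft, Pi.zero_apply, mul_zero, Finset.sum_const_zero, Complex.ofReal_zero,
    Complex.exp_zero, mul_one]
  rw [integral_complex_ofReal, hF.2.2, Complex.ofReal_one]

lemma norm_character_sub_one_le {N : ℕ} (v ξ : V N) :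
    ‖character v ξ - 1‖ ≤ √(∑ i, v i ^ 2) * √(∑ i, ξ i ^ 2) := by
  rw [character, neg_mul, ← mul_neg, ← Complex.ofReal_neg]
  refine Real.norm_exp_I_mul_ofReal_sub_one_le.trans ?_
  rw [norm_neg, Real.norm_eq_abs, ← Real.sqrt_mul (Finset.sum_nonneg fun i _ => sq_nonneg _)]
  exact Real.abs_le_sqrt (Finset.sum_mul_sq_le_sq_mul_sq _ _ _)

lemma norm_ft_sub_one_le {N : ℕ} {F : V N → ℝ} (hF : IsProbDensity F)
    (hF1 : Integrable fun v : V N => √(∑ i, v i ^ 2) * F v) (ξ : V N) :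
    ‖ft F ξ - 1‖ ≤ (∫ v, √(∑ i, v i ^ 2) * F v) * √(∑ i, ξ i ^ 2) := by
  have h1 : (∫ v, (F v : ℂ)) = 1 := by
    rw [integral_complex_ofReal, hF.2.2, Complex.ofReal_one]
  have h2 : Integrable fun v => (F v : ℂ) := hF.2.1.ofReal
  rw [← h1, ft_eq_integral_character,
    ← integral_sub (integrable_mul_character hF.2.1 ξ) h2, ← integral_mul_const]
  refine norm_integral_le_of_norm_le (hF1.mul_const _) (.of_forall fun v => ?_)
  rw [← mul_sub_one, norm_mul, Complex.norm_real, Real.norm_of_nonneg (hF.1 v)]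
  calc _ ≤ F v * (√(∑ i, v i ^ 2) * √(∑ i, ξ i ^ 2)) := by
        gcongr
        exacts [hF.1 v, norm_character_sub_one_le v ξ]
    _ = _ := by ring

lemma dT1_nonneg {N : ℕ} (F H : V N → ℝ) : 0 ≤ dT1 F H :=
  Real.iSup_nonneg fun _ => by positivity

lemma norm_ft_sub_le_dT1 {N : ℕ} {F H : V N → ℝ} (hF : IsProbDensity F)
    (hH : IsProbDensity H) (hF1 : Integrable fun v : V N => √(∑ i, v i ^ 2) * F v)
    (hH1 : Integrable fun v : V N => √(∑ i, v i ^ 2) * H v) (ξ : V N) :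
    ‖ft F ξ - ft H ξ‖ ≤ dT1 F H * √(∑ i, ξ i ^ 2) := by
  rcases eq_or_ne ξ 0 with rfl | hξ
  · simp [ft_zero hF, ft_zero hH]
  rw [← div_le_iff₀ (sqrt_sum_sq_pos hξ)]
  refine le_ciSup (f := fun ξ : {ξ : V N // ξ ≠ 0} =>
    ‖ft F ξ.1 - ft H ξ.1‖ / √(∑ i, (ξ.1 i) ^ 2)) ?_ ⟨ξ, hξ⟩
  refine ⟨(∫ v, √(∑ i, v i ^ 2) * F v) + ∫ v, √(∑ i, v i ^ 2) * H v, ?_⟩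
  rintro _ ⟨η, rfl⟩
  rw [div_le_iff₀ (sqrt_sum_sq_pos η.2), add_mul]
  have := norm_sub_le (ft F η.1 - 1) (ft H η.1 - 1)
  rw [sub_sub_sub_cancel_right] at this
  exact this.trans (add_le_add (norm_ft_sub_one_le hF hF1 _) (norm_ft_sub_one_le hH hH1 _))

theorem statement_14 (N : ℕ) (hN : 2 ≤ N) (lam mu : ℝ) (hlam : 0 < lam) (hmu : 0 < mu)
    (g : ℝ → ℝ) (hg : IsProbDensity1 g)
    (hg1 : Integrable (fun x => x * g x)) (hgmean : ∫ x, x * g x = 0)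
    (hg2 : Integrable (fun x => x ^ 2 * g x))
    (F H : V N → ℝ) (hF : IsProbDensity F) (hH : IsProbDensity H)
    (hF1 : Integrable (fun v : V N => Real.sqrt (∑ i, v i ^ 2) * F v))
    (hH1 : Integrable (fun v : V N => Real.sqrt (∑ i, v i ^ 2) * H v)) :
    dT1 (PhiOp (lam / (lam + mu)) g F) (PhiOp (lam / (lam + mu)) g H) ≤
      (1 - (1 - lam / (lam + mu)) / (4 * N)) * dT1 F H := by
  have hγ0 : 0 ≤ lam / (lam + mu) := by positivity
  have hγ1 : lam / (lam + mu) ≤ 1 := (div_le_one (by positivity)).2 (by linarith)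
  set γ := lam / (lam + mu)
  have hd := norm_ft_sub_le_dT1 hF hH hF1 hH1
  set d := dT1 F H
  have hd0 : 0 ≤ d := dT1_nonneg F H
  have hN0 : (0:ℝ) < N := by exact_mod_cast (by omega : 0 < N)
  have : Nonempty {ξ : V N // ξ ≠ 0} :=
    ⟨⟨fun _ => 1, Function.ne_iff.2 ⟨⟨0, by omega⟩, one_ne_zero⟩⟩⟩
  refine ciSup_le fun ⟨ξ, hξ⟩ => ?_
  have hr0 := sqrt_sum_sq_pos hξ
  have hr2 := Real.sq_sqrt (Finset.sum_nonneg fun i _ => sq_nonneg (ξ i) :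
    0 ≤ ∑ i, ξ i ^ 2)
  rw [div_le_iff₀ hr0, ft_PhiOp γ hg.2.1 hF.2.1, ft_PhiOp γ hg.2.1 hH.2.1, add_sub_add_comm,
    ← mul_sub, ← mul_sub, ← Finset.sum_sub_distrib]
  have hR := norm_sum_le_of_le Finset.univ fun j _ =>
    norm_ft_ROp_sub_le hg j hF.2.1 hH.2.1 hd0 hd hξ
  have hQ := norm_ft_QOp_sub_le hN hF.2.1 hH.2.1 hd ξ
  have hc : 0 ≤ (1 - γ) * (N : ℝ)⁻¹ := mul_nonneg (by linarith) (by positivity)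
  refine (norm_add_le _ _).trans ?_
  rw [norm_mul, norm_mul, Complex.norm_real, Complex.norm_real, Real.norm_of_nonneg hγ0,
    Real.norm_of_nonneg hc]
  refine (add_le_add (mul_le_mul_of_nonneg_left hQ hγ0)
    (mul_le_mul_of_nonneg_left hR hc)).trans_eq ?_
  rw [← Finset.mul_sum, Finset.sum_sub_distrib, ← Finset.sum_div, ← hr2]
  simp only [Real.sqrt_sq hr0.le, Finset.sum_const, Finset.card_univ, Fintype.card_fin,
    nsmul_eq_mul]
  field_simp
  ring

end
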